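/- Let q ∈ (0,1) be real and m ≥ 1 an integer. In the quantum matrix algebra ℂ_q[Mat_m], the row-ordered and the reversed column-ordered quantum determinants coincide: ∑_{s ∈ S_m} (−q)^{ℓ(s)} t_{1,s(1)} t_{2,s(2)} ⋯ t_{m,s(m)} = ∑_{s ∈ S_m} (−q)^{−ℓ(s)} t_{s(m),m} t_{s(m−1),m−1} ⋯ t_{s(1),1}, where ℓ(s) is the number of inversions of the permutation s. -/

import Mathlib

/-!
Quantum matrix algebra `ℂ_q[Mat_N]`, quantum determinant, `ℂ_q[SL_N]`,
and quantum minors, following the conventions of the paper.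
-/

noncomputable section

open scoped BigOperators

namespace QPaper

/-- Number of inversions of a permutation of `Fin k`. -/
def inversions {k : ℕ} (s : Equiv.Perm (Fin k)) : ℕ :=
  ((Finset.univ : Finset (Fin k × Fin k)).filter fun p => p.1 < p.2 ∧ s p.2 < s p.1).card

/-- The increasing enumeration of a finset of cardinality `k`. -/
def enum {α : Type*} [LinearOrder α] (J : Finset α) {k : ℕ} (h : J.card = k) : Fin k → α :=
  fun i => (J.orderIsoOfFin h i : α)

/-- Defining relations of the quantum matrix algebra `ℂ_q[Mat_N]`. -/
inductive qMatRel (q : ℝ) (N : ℕ) :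
    FreeAlgebra ℂ (Fin N × Fin N) → FreeAlgebra ℂ (Fin N × Fin N) → Prop
  | rowRel (i j l : Fin N) (h : j < l) :
      qMatRel q N (FreeAlgebra.ι ℂ (i, j) * FreeAlgebra.ι ℂ (i, l))
        ((q : ℂ) • (FreeAlgebra.ι ℂ (i, l) * FreeAlgebra.ι ℂ (i, j)))
  | colRel (i k j : Fin N) (h : i < k) :
      qMatRel q N (FreeAlgebra.ι ℂ (i, j) * FreeAlgebra.ι ℂ (k, j))
        ((q : ℂ) • (FreeAlgebra.ι ℂ (k, j) * FreeAlgebra.ι ℂ (i, j)))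
  | commRel (i k j l : Fin N) (h1 : i < k) (h2 : l < j) :
      qMatRel q N (FreeAlgebra.ι ℂ (i, j) * FreeAlgebra.ι ℂ (k, l))
        (FreeAlgebra.ι ℂ (k, l) * FreeAlgebra.ι ℂ (i, j))
  | qRel (i k j l : Fin N) (h1 : i < k) (h2 : j < l) :
      qMatRel q N
        (FreeAlgebra.ι ℂ (i, j) * FreeAlgebra.ι ℂ (k, l) -
          FreeAlgebra.ι ℂ (k, l) * FreeAlgebra.ι ℂ (i, j))
        (((q : ℂ) - (q : ℂ)⁻¹) • (FreeAlgebra.ι ℂ (i, l) * FreeAlgebra.ι ℂ (k, j)))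

/-- The quantum matrix algebra `ℂ_q[Mat_N]`. -/
abbrev QMat (q : ℝ) (N : ℕ) := RingQuot (qMatRel q N)

/-- The generators `t_{ij}` of `ℂ_q[Mat_N]` (`0`-based indices). -/
def T (q : ℝ) {N : ℕ} (i j : Fin N) : QMat q N :=
  RingQuot.mkAlgHom ℂ (qMatRel q N) (FreeAlgebra.ι ℂ (i, j))

/-- The quantum minor `t^{∧k}_{I,J}` of `ℂ_q[Mat_N]`, where the rows and columns are
given by the enumerations `row` and `col`. -/
def qMinor (q : ℝ) {N k : ℕ} (row col : Fin k → Fin N) : QMat q N :=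
  ∑ s : Equiv.Perm (Fin k),
    ((-(q : ℂ)) ^ inversions s) • (List.ofFn fun i => T q (row i) (col (s i))).prod

/-- The quantum determinant of `ℂ_q[Mat_N]`. -/
def qDet (q : ℝ) (N : ℕ) : QMat q N := qMinor q (id : Fin N → Fin N) id

/-- The relation `det_q T = 1`. -/
inductive qSLRel (q : ℝ) (N : ℕ) : QMat q N → QMat q N → Prop
  | det : qSLRel q N (qDet q N) 1

/-- The algebra `ℂ_q[SL_N]` of regular functions on the quantum group `SL_N`. -/
abbrev QSL (q : ℝ) (N : ℕ) := RingQuot (qSLRel q N)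

/-- The generators `t_{ij}` of `ℂ_q[SL_N]`. -/
def tSL (q : ℝ) {N : ℕ} (i j : Fin N) : QSL q N :=
  RingQuot.mkAlgHom ℂ (qSLRel q N) (T q i j)

/-- The quantum minor `t^{∧k}_{I,J}` in `ℂ_q[SL_N]`, where the rows and columns are
given by the enumerations `row` and `col`. -/
def sMinor (q : ℝ) {N k : ℕ} (row col : Fin k → Fin N) : QSL q N :=
  ∑ s : Equiv.Perm (Fin k),
    ((-(q : ℂ)) ^ inversions s) • (List.ofFn fun i => tSL q (row i) (col (s i))).prod

/-- Rows `{1,…,m}` inside `{1,…,m+n}`. -/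
def firstRows (m n : ℕ) : Fin m → Fin (m + n) := Fin.castLE (Nat.le_add_right m n)

/-- Rows `{m+1,…,N}` inside `{1,…,m+n}`. -/
def lastRows (m n : ℕ) : Fin n → Fin (m + n) := Fin.natAdd m

/-- Columns `{1,…,n}` inside `{1,…,m+n}`. -/
def firstCols (m n : ℕ) : Fin n → Fin (m + n) := Fin.castLE (Nat.le_add_left n m)

/-- Columns `{n+1,…,N}` inside `{1,…,m+n}`. -/
def lastCols (m n : ℕ) : Fin m → Fin (m + n) :=
  fun i => Fin.cast (Nat.add_comm n m) (Fin.natAdd n i)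


/-- Cardinality of the complement of a point in `{1,…,N}`. -/
theorem card_univ_erase {N : ℕ} (i : Fin N) :
    ((Finset.univ : Finset (Fin N)).erase i).card = N - 1 := by
  rw [Finset.card_erase_of_mem (Finset.mem_univ i), Finset.card_univ, Fintype.card_fin]

end QPaper

open QPaper

namespace QPaper

theorem inversions_one (m : ℕ) : inversions (1 : Equiv.Perm (Fin m)) = 0 := by
  simp only [inversions, Finset.card_eq_zero, Finset.filter_eq_empty_iff]
  rintro p - ⟨h₁, h₂⟩
  exact lt_asymm h₁ h₂

/-- Multiplying on the right by the transposition of two adjacent points in increasing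
position creates exactly one inversion. -/
theorem inversions_mul_swap {m : ℕ} (s : Equiv.Perm (Fin m)) {a b : Fin m}
    (hab : (a : ℕ) + 1 = b) (hs : s a < s b) :
    inversions (s * Equiv.swap a b) = inversions s + 1 := by
  have hlt : a < b := by rw [Fin.lt_def]; omega
  set τ := Equiv.swap a b with hτ
  have hmono : ∀ x y : Fin m, ¬ (x = a ∧ y = b) → x < y → τ x < τ y := by
    intro x y h hxy
    simp only [hτ, Equiv.swap_apply_def]
    split_ifs <;> simp only [Fin.lt_def, Fin.ext_iff] at * <;> omega
  have hinv : ∀ x, τ (τ x) = x := Equiv.swap_apply_self a b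
  unfold inversions
  conv_rhs =>
    rw [← Finset.card_map (τ.prodCongr τ).toEmbedding,
      ← Finset.card_insert_of_notMem (a := (a, b)) (by simp [hτ, hlt.not_gt])]
  congr 1
  ext ⟨x, y⟩
  simp only [Finset.mem_filter, Finset.mem_univ, true_and, Finset.mem_insert,
    Finset.mem_map_equiv, Equiv.Perm.mul_apply, Prod.mk.injEq, Equiv.prodCongr_symm,
    Equiv.prodCongr_apply, Prod.map_apply, hτ, Equiv.symm_swap]
  simp only [← hτ]
  by_cases h : x = a ∧ y = b
  · obtain ⟨rfl, rfl⟩ := h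
    simp [hτ, hlt, hs]
  · simp only [h, false_or]
    refine and_congr_left fun h' => ⟨hmono x y h, fun hxy => ?_⟩
    have := hmono (τ x) (τ y) ?_ hxy
    · simpa [hinv] using this
    · rintro ⟨h₁, h₂⟩
      rw [h₁, h₂] at h'
      exact lt_asymm hs h'

theorem inversions_mul_revPerm {m : ℕ} (s : Equiv.Perm (Fin m)) :
    inversions (s * Fin.revPerm) + inversions s =
      inversions (Fin.revPerm : Equiv.Perm (Fin m)) := by
  have h₁ : inversions (s * Fin.revPerm) =
      ((Finset.univ : Finset (Fin m × Fin m)).filter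
        fun p => p.1 < p.2 ∧ ¬ s p.2 < s p.1).card := by
    refine Finset.card_bij' (fun p _ => (p.2.rev, p.1.rev)) (fun p _ => (p.2.rev, p.1.rev))
      ?_ ?_ ?_ ?_
    · rintro p hp
      simp at hp ⊢
      exact ⟨hp.1, hp.2.le⟩
    · rintro p hp
      simp at hp ⊢
      exact ⟨hp.1, hp.2.lt_of_ne (s.injective.ne hp.1.ne)⟩
    · simp
    · simp
  have h₂ : inversions (Fin.revPerm : Equiv.Perm (Fin m)) =
      ((Finset.univ : Finset (Fin m × Fin m)).filter fun p => p.1 < p.2).card := by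
    simp [inversions]
  rw [h₁, h₂, inversions, add_comm, ← Finset.filter_filter, ← Finset.filter_filter,
    Finset.card_filter_add_card_filter_not]

/-- A permutation of `Fin m` other than the identity has an adjacent descent. -/
theorem exists_descent {m : ℕ} (s : Equiv.Perm (Fin m)) (hs : s ≠ 1) :
    ∃ a b : Fin m, (a : ℕ) + 1 = b ∧ s b < s a := by
  by_contra! h
  apply hs
  have hmono : StrictMono s := by
    cases m with
    | zero => exact fun x => x.elim0
    | succ n =>
      refine Fin.strictMono_iff_lt_succ.2 fun i => ?_
      exact (h i.castSucc i.succ (by simp)).lt_of_ne (s.injective.ne Fin.castSucc_lt_succ.ne)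
  ext x
  have : hmono.orderIsoOfSurjective s s.surjective = OrderIso.refl (Fin m) :=
    Subsingleton.elim _ _
  exact congrArg Fin.val (DFunLike.congr_fun this x)

/-- An ordered product factors around two adjacent positions, with outer factors depending only
on the other positions. -/
theorem exists_prod_ofFn_eq {R : Type*} [Monoid R] {n : ℕ} (f : Fin n → R) {a b : Fin n}
    (hab : (a : ℕ) + 1 = b) :
    ∃ L U : R, ∀ g : Fin n → R, (∀ i, i ≠ a → i ≠ b → g i = f i) →
      (List.ofFn g).prod = L * (g a * g b) * U := by
  induction n with
  | zero => exact a.elim0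
  | succ n ih =>
    cases b using Fin.cases with
    | zero => simp at hab
    | succ b =>
      cases a using Fin.cases with
      | zero =>
        cases n with
        | zero => exact b.elim0
        | succ n =>
          obtain rfl : b = 0 := by ext; simpa using hab.symm
          refine ⟨1, (List.ofFn fun i : Fin n => f i.succ.succ).prod, fun g hg => ?_⟩
          have : (fun i : Fin n => g i.succ.succ) = fun i => f i.succ.succ :=
            funext fun i => hg _ (Fin.succ_ne_zero _)
              ((Fin.succ_injective _).ne (Fin.succ_ne_zero _))
          simp [List.ofFn_succ, this, mul_assoc]
      | succ a =>
        obtain ⟨L, U, h⟩ := ih (fun i => f i.succ) (a := a) (b := b) (by simpa using hab)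
        refine ⟨f 0 * L, U, fun g hg => ?_⟩
        rw [List.ofFn_succ, List.prod_cons, h (fun i => g i.succ)
          fun i h₁ h₂ => hg _ ((Fin.succ_injective _).ne h₁) ((Fin.succ_injective _).ne h₂),
          hg 0 (Fin.succ_ne_zero _).symm (Fin.succ_ne_zero _).symm]
        simp only [mul_assoc]

section Algebra

variable {K R : Type*} [Field K] [Ring R] [Algebra K R]

/-- The two families of defining relations of the quantum matrix algebra involving four distinct
entries. -/
structure CrossRelations (q : K) {m : ℕ} (t : Fin m → Fin m → R) : Prop where
  comm : ∀ {i k j l : Fin m}, i < k → l < j → t i j * t k l = t k l * t i j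
  sub : ∀ {i k j l : Fin m}, i < k → j < l →
    t i j * t k l - t k l * t i j = (q - q⁻¹) • (t i l * t k j)

/-- The quantum determinant with the rows taken in the order `σ`. -/
def rowDet (q : K) {m : ℕ} (t : Fin m → Fin m → R) (σ : Equiv.Perm (Fin m)) : R :=
  ∑ s : Equiv.Perm (Fin m), ((-q) ^ inversions s) • (List.ofFn fun i => t (σ i) (s i)).prod

variable {q : K} {m : ℕ} {t : Fin m → Fin m → R}

theorem CrossRelations.transpose (h : CrossRelations q t) :
    CrossRelations q fun i j => t j i where
  comm h₁ h₂ := (h.comm h₂ h₁).symm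
  sub h₁ h₂ := by rw [h.sub h₂ h₁, h.comm h₂ h₁]

theorem CrossRelations.rowDet_mul_swap (h : CrossRelations q t) (hq : q ≠ 0)
    (σ : Equiv.Perm (Fin m)) {a b : Fin m} (hab : (a : ℕ) + 1 = b) (hσ : σ a < σ b) :
    rowDet q t (σ * Equiv.swap a b) = (-q) • rowDet q t σ := by
  have hne : a ≠ b := by rintro rfl; omega
  set τ := Equiv.swap a b with hτ
  rw [← sub_eq_zero, rowDet, rowDet, Finset.smul_sum, ← Finset.sum_sub_distrib]
  have key : ∀ s : Equiv.Perm (Fin m), s a < s b →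
      (((-q) ^ inversions s) • (List.ofFn fun i => t ((σ * τ) i) (s i)).prod -
        (-q) • ((-q) ^ inversions s) • (List.ofFn fun i => t (σ i) (s i)).prod) +
      (((-q) ^ inversions (s * τ)) • (List.ofFn fun i => t ((σ * τ) i) ((s * τ) i)).prod -
        (-q) • ((-q) ^ inversions (s * τ)) •
          (List.ofFn fun i => t (σ i) ((s * τ) i)).prod) = 0 := by
    intro s hs
    obtain ⟨L, U, hLU⟩ := exists_prod_ofFn_eq (fun i => t (σ i) (s i)) hab
    have hoff : ∀ i, i ≠ a → i ≠ b → τ i = i := fun i => Equiv.swap_apply_of_ne_of_ne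
    rw [hLU (fun i => t (σ i) (s i)) (fun _ _ _ => rfl),
      hLU (fun i => t ((σ * τ) i) (s i)) (fun i h₁ h₂ => by simp [hoff i h₁ h₂]),
      hLU (fun i => t ((σ * τ) i) ((s * τ) i)) (fun i h₁ h₂ => by simp [hoff i h₁ h₂]),
      hLU (fun i => t (σ i) ((s * τ) i)) (fun i h₁ h₂ => by simp [hoff i h₁ h₂]),
      inversions_mul_swap s hab hs]
    have e₁ := h.comm hσ hs
    have e₂ := sub_eq_iff_eq_add.1 (h.sub hσ hs)
    simp only [hτ, Equiv.Perm.mul_apply, Equiv.swap_apply_left, Equiv.swap_apply_right]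
    rw [e₂, ← e₁]
    simp only [mul_add, add_mul, mul_smul_comm, smul_mul_assoc, pow_succ]
    match_scalars <;> field_simp <;> ring
  refine Finset.sum_involution (fun s _ => s * τ) ?_ ?_ (fun _ _ => Finset.mem_univ _) ?_
  · intro s _
    rcases (s.injective.ne hne).lt_or_gt with hs | hs
    · exact key s hs
    · have := key (s * τ) (by simpa [hτ] using hs)
      rw [mul_assoc s τ τ, Equiv.swap_mul_self, mul_one] at this
      rw [add_comm]
      exact this
  · intro s _ _ he
    exact hne (Equiv.swap_eq_one_iff.1 (mul_eq_left.1 he))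
  · intro s _
    simp [hτ, mul_assoc]

theorem CrossRelations.rowDet_eq (h : CrossRelations q t) (hq : q ≠ 0)
    (σ : Equiv.Perm (Fin m)) :
    rowDet q t σ = ((-q) ^ inversions σ) • rowDet q t 1 := by
  induction hn : inversions σ generalizing σ with
  | zero =>
    by_cases hσ : σ = 1
    · simp [hσ]
    · obtain ⟨a, b, hab, hlt⟩ := exists_descent σ hσ
      have := inversions_mul_swap (σ * Equiv.swap a b) hab (by simpa using hlt)
      rw [mul_assoc, Equiv.swap_mul_self, mul_one] at this
      omega
  | succ n ih =>
    have hσ : σ ≠ 1 := by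
      rintro rfl
      simp [inversions_one] at hn
    obtain ⟨a, b, hab, hlt⟩ := exists_descent σ hσ
    have hlt' : (σ * Equiv.swap a b) a < (σ * Equiv.swap a b) b := by simpa using hlt
    have hinv := inversions_mul_swap (σ * Equiv.swap a b) hab hlt'
    have hdet := h.rowDet_mul_swap hq (σ * Equiv.swap a b) hab hlt'
    rw [mul_assoc, Equiv.swap_mul_self, mul_one] at hinv hdet
    rw [hdet, ih _ (by omega), smul_smul, pow_succ']

/-- The quantum determinant is invariant under transposition. -/
theorem CrossRelations.rowDet_transpose (h : CrossRelations q t) (hq : q ≠ 0)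
    (hsum : ∑ s : Equiv.Perm (Fin m), (q ^ 2) ^ inversions s ≠ 0) :
    rowDet q (fun i j => t j i) 1 = rowDet q t 1 := by
  have key : ∀ {u : Fin m → Fin m → R}, CrossRelations q u →
      ∑ σ : Equiv.Perm (Fin m), ((-q) ^ inversions σ) • rowDet q u σ =
        (∑ s : Equiv.Perm (Fin m), (q ^ 2) ^ inversions s) • rowDet q u 1 := by
    intro u hu
    rw [Finset.sum_smul]
    refine Finset.sum_congr rfl fun σ _ => ?_
    rw [hu.rowDet_eq hq, smul_smul, ← mul_pow, neg_mul_neg, sq]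
  apply smul_right_injective R hsum
  change _ • _ = _ • _
  rw [← key h, ← key h.transpose]
  simp only [rowDet, Finset.smul_sum]
  rw [Finset.sum_comm]
  refine Finset.sum_congr rfl fun s _ => Finset.sum_congr rfl fun σ _ => ?_
  rw [smul_comm]

end Algebra

theorem crossRelations_T (q : ℝ) (m : ℕ) :
    CrossRelations (q : ℂ) (T q : Fin m → Fin m → QMat q m) where
  comm h₁ h₂ := by
    simpa only [T, map_mul] using
      RingQuot.mkAlgHom_rel ℂ (qMatRel.commRel (q := q) _ _ _ _ h₁ h₂)
  sub h₁ h₂ := by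
    simpa only [T, map_mul, map_sub, map_smul] using
      RingQuot.mkAlgHom_rel ℂ (qMatRel.qRel (q := q) _ _ _ _ h₁ h₂)

end QPaper

/-- In `ℂ_q[Mat_m]` the row-ordered quantum determinant coincides with
the reversed column-ordered one:
`∑_s (−q)^{ℓ(s)} t_{1,s(1)}⋯t_{m,s(m)} = ∑_s (−q)^{−ℓ(s)} t_{s(m),m}⋯t_{s(1),1}`. -/
theorem qDet_eq_qDet' (q : ℝ) (hq0 : 0 < q) (hq1 : q < 1) (m : ℕ) (hm : 0 < m) :
    (∑ s : Equiv.Perm (Fin m),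
        ((-(q : ℂ)) ^ inversions s) • (List.ofFn fun i => T q i (s i)).prod) =
      ∑ s : Equiv.Perm (Fin m),
        ((-(q : ℂ)) ^ (-(inversions s : ℤ))) •
          (List.ofFn fun i => T q (s (Fin.rev i)) (Fin.rev i)).prod := by
  have hq : (q : ℂ) ≠ 0 := by exact_mod_cast hq0.ne'
  have hT := crossRelations_T q m
  have hsum : ∑ s : Equiv.Perm (Fin m), ((q : ℂ) ^ 2) ^ inversions s ≠ 0 := by
    have : 0 < ∑ s : Equiv.Perm (Fin m), (q ^ 2) ^ inversions s :=
      Finset.sum_pos (fun _ _ => by positivity) Finset.univ_nonempty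
    exact_mod_cast this.ne'
  change rowDet (q : ℂ) (T q) 1 = _
  rw [← hT.rowDet_transpose hq hsum]
  have hrev := hT.transpose.rowDet_eq hq Fin.revPerm
  rw [← inv_smul_eq_iff₀ (pow_ne_zero _ (neg_ne_zero.2 hq))] at hrev
  rw [← hrev, rowDet, Finset.smul_sum]
  refine (Fintype.sum_equiv (Equiv.mulRight Fin.revPerm) _ _ fun s => ?_).symm
  simp only [Equiv.coe_mulRight, Equiv.Perm.mul_apply, Fin.revPerm_apply, smul_smul]
  congr 1
  rw [← inversions_mul_revPerm s, pow_add, mul_inv_rev, inv_mul_cancel_right₀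
    (pow_ne_zero _ (neg_ne_zero.2 hq)), zpow_neg, zpow_natCast]
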